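/- Let f = T_L ∘ ReLU⃗ ∘ T_{L−1} ∘ ⋯ ∘ ReLU⃗ ∘ T₁ be a deep ReLU neural network of constant width p ≥ 2, where each T_ℓ : ℝ^p → ℝ^p is an affine map, ReLU⃗ applies x ↦ max(x, 0) componentwise, and the input and output are (after zero-padding) in ℝ^p. Then there exist at most 2L functions ψ₁, …, ψ_{2L} : ℝ^p → ℝ^p, each admitting a tensor-train representation with ranks at most (p, p, …, p, 1) and with every entry of the k-th matrix factor lying in span{1, x, |x|} as a function of the k-th variable, such that f = (Id + ψ_{2L}) ∘ ⋯ ∘ (Id + ψ₁) on ℝ^p. In particular, any deep ReLU network with L layers and constant width p can be written exactly as a compositional tensor train with 2L layers over the basis Φ = {1, x, |x|}, using the identity max(x, 0) = (x + |x|)/2. -/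

import Mathlib

noncomputable def ttProdAux {d : ℕ} (r : Fin (d + 1) → ℕ)
    (U : ∀ i : Fin d, Matrix (Fin (r i.castSucc)) (Fin (r i.succ)) ℝ) :
    ∀ k : Fin (d + 1), Matrix (Fin (r 0)) (Fin (r k)) ℝ :=
  Fin.induction (motive := fun k => Matrix (Fin (r 0)) (Fin (r k)) ℝ) 1
    fun i acc => acc * U i

noncomputable def ttProd {d : ℕ} (r : Fin (d + 1) → ℕ)
    (U : ∀ i : Fin d, Matrix (Fin (r i.castSucc)) (Fin (r i.succ)) ℝ) :
    Matrix (Fin (r 0)) (Fin (r (Fin.last d))) ℝ :=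
  ttProdAux r U (Fin.last d)

def AffineEntry (f : ℝ → ℝ) : Prop := ∃ a b : ℝ, ∀ t, f t = a * t + b

def AffineFactor {m n : ℕ} (U : ℝ → Matrix (Fin m) (Fin n) ℝ) : Prop :=
  ∀ i j, AffineEntry fun t => U t i j

theorem ttProdAux_zero {d : ℕ} (r : Fin (d + 1) → ℕ)
    (U : ∀ i : Fin d, Matrix (Fin (r i.castSucc)) (Fin (r i.succ)) ℝ) :
    ttProdAux r U 0 = 1 :=
  rfl

theorem ttProdAux_succ {d : ℕ} (r : Fin (d + 1) → ℕ)
    (U : ∀ i : Fin d, Matrix (Fin (r i.castSucc)) (Fin (r i.succ)) ℝ) (i : Fin d) :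
    ttProdAux r U i.succ = ttProdAux r U i.castSucc * U i :=
  Fin.induction_succ ..

/-- If the entries of the cores are given by `N`, a family indexed by natural numbers, and `P`
satisfies the recursion of the partial products, then `P` gives the entries of `ttProdAux`. -/
theorem ttProdAux_apply {d : ℕ} (r : Fin (d + 1) → ℕ)
    (U : ∀ i : Fin d, Matrix (Fin (r i.castSucc)) (Fin (r i.succ)) ℝ)
    (N P : ℕ → ℕ → ℕ → ℝ) (hU : ∀ i a c, U i a c = N i a c)
    (hP0 : ∀ a c, P 0 a c = if a = c then 1 else 0)
    (hP : ∀ (i : Fin d) (a : Fin (r 0)) (c : Fin (r i.succ)),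
      P (i + 1) a c = ∑ j ∈ Finset.range (r i.castSucc), P i a j * N i j c)
    (k : Fin (d + 1)) (a : Fin (r 0)) (c : Fin (r k)) :
    ttProdAux r U k a c = P k a c := by
  induction k using Fin.induction with
  | zero => simp [ttProdAux_zero, Matrix.one_apply, hP0, Fin.ext_iff]
  | succ i ih =>
    rw [ttProdAux_succ, Matrix.mul_apply, Fin.val_succ, hP,
      ← Fin.sum_univ_eq_sum_range fun j => P i a j * N i j c]
    exact Finset.sum_congr rfl fun j _ => by rw [ih, hU, Fin.val_castSucc]

/-- Membership in the span of `1`, `x` and `|x|`. -/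
def InAbsSpan (g : ℝ → ℝ) : Prop := ∃ c0 c1 c2 : ℝ, ∀ t, g t = c0 + c1 * t + c2 * |t|

theorem InAbsSpan.const (c : ℝ) : InAbsSpan fun _ => c :=
  ⟨c, 0, 0, fun t => by ring⟩

theorem InAbsSpan.affine (a c : ℝ) : InAbsSpan fun t => a * t + c :=
  ⟨c, a, 0, fun t => by ring⟩

theorem InAbsSpan.max_sub_self : InAbsSpan fun t => max t 0 - t :=
  ⟨0, -1 / 2, 1 / 2, fun t => by
    dsimp only
    rcases le_total t 0 with h | h
    · rw [max_eq_right h, abs_of_nonpos h]; ring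
    · rw [max_eq_left h, abs_of_nonneg h]; ring⟩

/-- Tensor-train representability with ranks at most `(p, …, p, 1)` over `{1, x, |x|}`. -/
def HasAbsTT (p : ℕ) (φ : (Fin p → ℝ) → Fin p → ℝ) : Prop :=
  ∃ (r : Fin (p + 1) → ℕ) (h0 : r 0 = p),
    r (Fin.last p) = 1 ∧ (∀ k : Fin (p + 1), r k ≤ p) ∧
    ∃ U : ∀ i : Fin p, ℝ → Matrix (Fin (r i.castSucc)) (Fin (r i.succ)) ℝ,
      (∀ i a c, ∃ c0 c1 c2 : ℝ, ∀ t, U i t a c = c0 + c1 * t + c2 * |t|) ∧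
      ∀ y : Fin p → ℝ, ∀ (a : Fin (r 0)) (c : Fin (r (Fin.last p))),
        ttProd r (fun k => U k (y k)) a c = φ y (Fin.cast h0 a)

/-- A first core `B` followed by diagonal cores, the `k`-th one acting by `g` on the `k`-th
coordinate only. -/
theorem hasAbsTT_of_diagonal {p : ℕ} (hp : 2 ≤ p) (φ : (Fin p → ℝ) → Fin p → ℝ)
    (B : ℝ → ℕ → ℕ → ℝ) (g : ℝ → ℝ) (hB : ∀ a c, InAbsSpan fun t => B t a c)
    (hg : InAbsSpan g)
    (hφ : ∀ y a, φ y a =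
      ∑ j : Fin p, B (y ⟨0, by omega⟩) a j * if (j : ℕ) = 0 then 1 else g (y j)) :
    HasAbsTT p φ := by
  let N : ℕ → ℝ → ℕ → ℕ → ℝ := fun i t a c =>
    if i = 0 then B t a c
    else if a = c ∨ i + 1 = p then (if a = i then g t else 1) else 0
  refine ⟨fun k => if (k : ℕ) = p then 1 else p, if_neg (by simp; omega), by simp,
    fun k => by dsimp only; split_ifs <;> omega, fun i t => Matrix.of fun a c => N i t a c,
    fun i a c => ?_, fun y a c => ?_⟩
  · change InAbsSpan fun t => N i t a c
    simp only [N]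
    by_cases h0 : (i : ℕ) = 0
    · simpa only [if_pos h0] using hB _ _
    by_cases hac : (a : ℕ) = c ∨ (i : ℕ) + 1 = p
    · by_cases hai : (a : ℕ) = i
      · simpa only [if_neg h0, if_pos hac, if_pos hai] using hg
      · simpa only [if_neg h0, if_pos hac, if_neg hai] using .const 1
    · simpa only [if_neg h0, if_neg hac] using .const 0
  · let z : ℕ → ℝ := fun n => if h : n < p then y ⟨n, h⟩ else 0
    have hz : ∀ i : Fin p, z i = y i := fun i => by simp [z]
    let Q : ℕ → ℕ → ℕ → ℝ := fun k a c =>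
      B (z 0) a c * if c = 0 ∨ k ≤ c then 1 else g (z c)
    let P : ℕ → ℕ → ℕ → ℝ := fun k a c =>
      if k = 0 then (if a = c then 1 else 0)
      else if k = p then ∑ j ∈ Finset.range p, Q p a j
      else Q k a c
    rw [ttProd, ttProdAux_apply _ _ (fun i => N i (z i)) P]
    · have hp0 : p ≠ 0 := by omega
      simp only [P, Q, Fin.val_last, hp0, if_true, if_false, hφ]
      rw [← Fin.sum_univ_eq_sum_range
        fun j => B (z 0) a j * if j = 0 ∨ p ≤ j then 1 else g (z j)]
      refine Finset.sum_congr rfl fun j _ => ?_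
      rw [← hz, ← hz]
      simp only [or_iff_left (not_le.2 j.2), Fin.val_cast]
    · intro i a c
      simp [hz]
    · intro a c
      simp [P]
    · intro i a c
      have hi := i.2
      have ha : (a : ℕ) < p := by
        refine a.2.trans_eq (if_neg ?_)
        simp only [Fin.val_zero]
        omega
      have hip : (i : ℕ) ≠ p := by omega
      simp only [Fin.val_castSucc, hip, if_false]
      rcases Nat.eq_zero_or_pos (i : ℕ) with h0 | h0
      · have h1 : 1 ≠ p := by omega
        have h2 : (c : ℕ) = 0 ∨ 1 ≤ (c : ℕ) := by omega
        simp [P, N, Q, h0, h1, h2, ha]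
      · have hi0 : (i : ℕ) ≠ 0 := by omega
        by_cases hl : (i : ℕ) + 1 = p
        · simp only [P, N, hl, hi0, hip, if_false, if_true, or_true]
          rw [if_neg (by omega : p ≠ 0)]
          refine Finset.sum_congr rfl fun j hj => ?_
          have hj := Finset.mem_range.1 hj
          simp only [Q, mul_assoc]
          congr 1
          by_cases hji : j = i
          · subst hji
            simp [hi0, hi]
          · have : (j = 0 ∨ p ≤ j) ↔ (j = 0 ∨ (i : ℕ) ≤ j) := by omega
            simp [hji, this]
        · have hc : (c : ℕ) < p := by
            have := c.2
            simpa [hl] using this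
          simp only [P, N, hl, hi0, hip, if_false, or_false, Nat.succ_ne_zero, mul_ite, mul_zero]
          rw [Finset.sum_ite_eq' (Finset.range p) (c : ℕ), if_pos (Finset.mem_range.2 hc)]
          simp only [Q]
          by_cases hci : (c : ℕ) = i
          · simp [hci, hi0]
          · have : ((c : ℕ) = 0 ∨ (i : ℕ) + 1 ≤ c) ↔ ((c : ℕ) = 0 ∨ (i : ℕ) ≤ c) := by omega
            simp only [this, hci, if_false, mul_one]

theorem hasAbsTT_affine {p : ℕ} (hp : 2 ≤ p) (A : Matrix (Fin p) (Fin p) ℝ) (v : Fin p → ℝ) :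
    HasAbsTT p fun y => A.mulVec y + v := by
  let A' : ℕ → ℕ → ℝ := fun a c => if h : a < p ∧ c < p then A ⟨a, h.1⟩ ⟨c, h.2⟩ else 0
  let v' : ℕ → ℝ := fun a => if h : a < p then v ⟨a, h⟩ else 0
  have hA : ∀ a c : Fin p, A' a c = A a c := fun a c => by simp [A']
  have hv : ∀ a : Fin p, v' a = v a := fun a => by simp [v']
  refine hasAbsTT_of_diagonal hp _
    (fun t a c => if c = 0 then A' a c * t + v' a else A' a c) (fun t => t) (fun a c => ?_)
    ⟨0, 1, 0, fun t => by ring⟩ fun y a => ?_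
  · split_ifs
    exacts [.affine _ _, .const _]
  · have hv0 : v a = ∑ j : Fin p, if j = ⟨0, by omega⟩ then v a else 0 := by simp
    rw [Pi.add_apply, hv0, Matrix.mulVec, dotProduct, ← Finset.sum_add_distrib]
    refine Finset.sum_congr rfl fun j _ => ?_
    by_cases hj : j = ⟨0, by omega⟩
    · subst hj
      simp [← hA, hv]
    · have : (j : ℕ) ≠ 0 := fun h => hj (Fin.ext h)
      simp [hj, this, hA]

theorem hasAbsTT_componentwise {p : ℕ} (hp : 2 ≤ p) (g : ℝ → ℝ) (hg : InAbsSpan g) :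
    HasAbsTT p fun y i => g (y i) := by
  refine hasAbsTT_of_diagonal hp _
    (fun t a c => if a = c then (if c = 0 then g t else 1) else 0) g (fun a c => ?_) hg
    fun y a => ?_
  · split_ifs
    exacts [hg, .const 1, .const 0]
  · rw [Finset.sum_eq_single a]
    · by_cases ha : (a : ℕ) = 0
      · have : a = ⟨0, by omega⟩ := Fin.ext ha
        simp [← this, ha]
      · simp [ha]
    · intro j _ hj
      simp [Fin.val_inj, hj.symm]
    · simp

/-- A deep ReLU network of constant width p and L layers can be written
exactly as a compositional tensor train with at most 2L layers over the basis
Φ = {1, x, |x|}: each layer has a TT representation with ranks at most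
(p, p, …, p, 1) whose k-th factor has entries in span{1, x, |x|} as functions of the
k-th variable. -/
theorem stmt_11 (p L : ℕ) (hp : 2 ≤ p) (hL : 1 ≤ L)
    (W : ℕ → Matrix (Fin p) (Fin p) ℝ) (b : ℕ → Fin p → ℝ)
    (f : (Fin p → ℝ) → Fin p → ℝ)
    (hf : ∀ x, f x = (W (L - 1)).mulVec
        ((List.range (L - 1)).foldl
          (fun y k => fun i => max (((W k).mulVec y + b k) i) 0) x) + b (L - 1)) :
    ∃ M : ℕ, M ≤ 2 * L ∧
      ∃ ψ : ℕ → (Fin p → ℝ) → Fin p → ℝ,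
        (∀ ℓ < M, ∃ (r : Fin (p + 1) → ℕ) (h0 : r 0 = p),
          r (Fin.last p) = 1 ∧ (∀ k : Fin (p + 1), r k ≤ p) ∧
          ∃ U : ∀ i : Fin p, ℝ → Matrix (Fin (r i.castSucc)) (Fin (r i.succ)) ℝ,
            (∀ i a c, ∃ c0 c1 c2 : ℝ, ∀ t, U i t a c = c0 + c1 * t + c2 * |t|) ∧
            ∀ y : Fin p → ℝ, ∀ (a : Fin (r 0)) (c : Fin (r (Fin.last p))),
              ttProd r (fun k => U k (y k)) a c = ψ ℓ y (Fin.cast h0 a)) ∧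
        ∀ x : Fin p → ℝ, f x = (List.range M).foldl (fun y ℓ => y + ψ ℓ y) x := by
  let ψ : ℕ → (Fin p → ℝ) → Fin p → ℝ := fun ℓ =>
    if ℓ % 2 = 0 then fun y => (W (ℓ / 2) - 1).mulVec y + b (ℓ / 2)
    else fun y i => max (y i) 0 - y i
  have hψ_even : ∀ n y, y + ψ (2 * n) y = (W n).mulVec y + b n := fun n y => by
    simp only [ψ, Nat.mul_mod_right, if_true, Nat.mul_div_cancel_left n two_pos,
      Matrix.sub_mulVec, Matrix.one_mulVec]
    abel
  have hψ_odd : ∀ n y, y + ψ (2 * n + 1) y = fun i => max (y i) 0 := fun n y => by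
    funext i
    simp [ψ]
  have hfold : ∀ n x, (List.range (2 * n)).foldl (fun y ℓ => y + ψ ℓ y) x =
      (List.range n).foldl (fun y k => fun i => max (((W k).mulVec y + b k) i) 0) x := by
    intro n x
    induction n with
    | zero => rfl
    | succ n ih =>
      rw [Nat.mul_succ, List.range_succ, List.range_succ, List.range_succ]
      simp only [List.foldl_append, List.foldl_cons, List.foldl_nil, ih, hψ_even, hψ_odd]
  refine ⟨2 * (L - 1) + 1, by omega, ψ, fun ℓ _ => ?_, fun x => ?_⟩
  · change HasAbsTT p (ψ ℓ)
    simp only [ψ]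
    split_ifs
    exacts [hasAbsTT_affine hp _ _, hasAbsTT_componentwise hp _ .max_sub_self]
  · rw [List.range_succ, List.foldl_append, hfold, List.foldl_cons, List.foldl_nil, hψ_even, hf]
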